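/- Let 0 < j < 3^n − 1 and let h = (3^k+1)j mod (3^n−1) with ternary digits h_i. Suppose j ∈ S_0, h_0 = h_1 = 1, and the ternary digits of j satisfy (j_1, j_0) = (0, 1). Then j_{ik mod n} = 1 for all 0 ≤ i ≤ w−1; j_{ik mod n} = 0 for i ∈ {w, n−1}; j_{ik mod n} ∈ {0, 2} for all w+1 ≤ i ≤ n−2; and no two consecutive terms of the sequence j_{(w+1)k mod n}, j_{(w+2)k mod n}, …, j_{(n−2)k mod n} both equal 2. -/

import Mathlib

/-- The `i`-th ternary digit (indices read modulo `n`) of the residue of `j` modulo `3^n - 1`. -/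
def dig (n : ℕ) (j : ℤ) (i : ℕ) : ℕ :=
  ((j % ((3 : ℤ) ^ n - 1)).toNat / 3 ^ (i % n)) % 3

/-- The ternary weight of (the residue modulo `3^n - 1` of) `j`. -/
def wt (n : ℕ) (j : ℤ) : ℕ := ∑ i ∈ Finset.range n, dig n j i

/-- `d = (3^k + 1)/2`. -/
def cmD (k : ℕ) : ℤ := ((3 : ℤ) ^ k + 1) / 2

/-- The set `S_0`. -/
def S0 (n k : ℕ) : Set ℤ :=
  {j | 0 < j ∧ j < 3 ^ n - 1 ∧
    wt n j + wt n (3 ^ k * j) = wt n ((3 ^ k + 1) * j) ∧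
    2 * wt n (-(j * cmD k)) = wt n (-((3 ^ k + 1) * j)) + 2}

theorem dig_mod (n : ℕ) (x : ℤ) (i : ℕ) : dig n x (i % n) = dig n x i := by
  simp [dig]

theorem dig_congr {n : ℕ} (x : ℤ) {a b : ℕ} (h : a ≡ b [MOD n]) : dig n x a = dig n x b := by
  rw [← dig_mod n x a, ← dig_mod n x b, h]

/-- The reduced residue of `x` modulo `3 ^ n - 1`, as a natural number. -/
def res (n : ℕ) (x : ℤ) : ℕ := (x % ((3 : ℤ) ^ n - 1)).toNat

theorem dig_eq_res {n i : ℕ} (x : ℤ) (hi : i < n) : dig n x i = res n x / 3 ^ i % 3 := by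
  simp [dig, res, Nat.mod_eq_of_lt hi]

theorem three_pow_ge {n : ℕ} (hn : 0 < n) : 3 ≤ 3 ^ n :=
  Nat.le_self_pow hn.ne' 3

theorem cast_res {n : ℕ} (hn : 0 < n) (x : ℤ) : (res n x : ℤ) = x % ((3 : ℤ) ^ n - 1) := by
  have h : (3 : ℤ) ≤ 3 ^ n := mod_cast three_pow_ge hn
  exact Int.toNat_of_nonneg (Int.emod_nonneg _ (by omega))

theorem res_add_one_lt {n : ℕ} (hn : 0 < n) (x : ℤ) : res n x + 1 < 3 ^ n := by
  have h : (3 : ℤ) ≤ 3 ^ n := mod_cast three_pow_ge hn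
  have h1 := Int.emod_lt_of_pos x (b := (3 : ℤ) ^ n - 1) (by omega)
  rw [← cast_res hn] at h1
  have h2 : (res n x : ℤ) + 1 < 3 ^ n := by omega
  exact_mod_cast h2

theorem res_eq_of_modEq {n : ℕ} (hn : 0 < n) {x : ℤ} {s : ℕ} (hs : s + 1 < 3 ^ n)
    (h : (s : ℤ) ≡ x [ZMOD (3 : ℤ) ^ n - 1]) : res n x = s := by
  have hs' : (s : ℤ) + 1 < 3 ^ n := mod_cast hs
  have h1 : (s : ℤ) % ((3 : ℤ) ^ n - 1) = s := Int.emod_eq_of_lt (by omega) (by omega)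
  have h2 := cast_res hn x
  rw [← h, h1] at h2
  exact_mod_cast h2

theorem res_modEq {n : ℕ} (hn : 0 < n) (x : ℤ) : (res n x : ℤ) ≡ x [ZMOD (3 : ℤ) ^ n - 1] := by
  rw [cast_res hn]
  exact Int.mod_modEq _ _

/-- Addition modulo `3 ^ n - 1` is ternary addition with an end-around carry. -/
theorem exists_res_add {n : ℕ} (hn : 0 < n) (x y : ℤ) :
    ∃ e ≤ 1, res n x + res n y + e = res n (x + y) + 3 ^ n * e := by
  have hx := res_add_one_lt hn x
  have hy := res_add_one_lt hn y
  have hxy := (res_modEq hn x).add (res_modEq hn y)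
  by_cases h : res n x + res n y + 1 < 3 ^ n
  · refine ⟨0, by omega, ?_⟩
    rw [res_eq_of_modEq (x := x + y) hn h (by push_cast; exact hxy)]
    simp
  · refine ⟨1, le_rfl, ?_⟩
    rw [res_eq_of_modEq (x := x + y) (s := res n x + res n y + 1 - 3 ^ n) hn (by omega)]
    · omega
    · rw [Nat.cast_sub (by omega)]
      push_cast
      refine Int.ModEq.trans ?_ hxy
      refine (Int.modEq_iff_dvd).2 ⟨1, by ring⟩

theorem exists_carry {n : ℕ} (hn : 0 < n) (x y : ℤ) :
    ∃ c : ℕ → ℕ, (∀ i, c i ≤ 1) ∧ c n = c 0 ∧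
      ∀ i < n, dig n x i + dig n y i + c i = dig n (x + y) i + 3 * c (i + 1) := by
  obtain ⟨e, he, hsum⟩ := exists_res_add hn x y
  have hx := res_add_one_lt hn x
  have hy := res_add_one_lt hn y
  have hxy := res_add_one_lt hn (x + y)
  set a := res n x
  set b := res n y
  set s := res n (x + y)
  have hpos : ∀ i, 0 < 3 ^ i := fun i => by positivity
  have key : ∀ i ≤ n, a % 3 ^ i + b % 3 ^ i + e =
      s % 3 ^ i + 3 ^ i * ((a % 3 ^ i + b % 3 ^ i + e) / 3 ^ i) := by
    intro i hi
    have h1 : (a % 3 ^ i + b % 3 ^ i + e) % 3 ^ i = s % 3 ^ i := by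
      have h2 : (a % 3 ^ i + b % 3 ^ i + e) % 3 ^ i = (a + b + e) % 3 ^ i := by
        simp [Nat.add_mod]
      obtain ⟨t, ht⟩ := pow_dvd_pow 3 hi
      rw [h2, hsum, ht, mul_assoc, Nat.add_mul_mod_self_left]
    rw [← h1]
    exact (Nat.mod_add_div _ _).symm
  refine ⟨fun i => (a % 3 ^ i + b % 3 ^ i + e) / 3 ^ i, fun i => ?_, ?_, fun i hi => ?_⟩
  · have h1 := Nat.mod_lt a (hpos i)
    have h2 := Nat.mod_lt b (hpos i)
    exact Nat.le_of_lt_succ ((Nat.div_lt_iff_lt_mul (hpos i)).2 (by omega))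
  · have h1 : a % 3 ^ n = a := Nat.mod_eq_of_lt (by omega)
    have h2 : b % 3 ^ n = b := Nat.mod_eq_of_lt (by omega)
    simp only [h1, h2, hsum, pow_zero, Nat.mod_one, Nat.div_one, zero_add]
    rw [Nat.add_mul_div_left _ _ (hpos n), Nat.div_eq_of_lt (by omega), zero_add]
  · have h1 := key i hi.le
    have h2 := key (i + 1) hi
    simp only [dig_eq_res _ hi]
    generalize (a % 3 ^ i + b % 3 ^ i + e) / 3 ^ i = c at *
    generalize (a % 3 ^ (i + 1) + b % 3 ^ (i + 1) + e) / 3 ^ (i + 1) = c' at *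
    rw [Nat.mod_pow_succ, Nat.mod_pow_succ, Nat.mod_pow_succ, pow_succ] at h2
    change a / 3 ^ i % 3 + b / 3 ^ i % 3 + c = s / 3 ^ i % 3 + 3 * c'
    refine Nat.eq_of_mul_eq_mul_left (hpos i) ?_
    linarith

theorem wt_add_of_carry {n : ℕ} {x y : ℤ} {c : ℕ → ℕ} (hc : c n = c 0)
    (h : ∀ i < n, dig n x i + dig n y i + c i = dig n (x + y) i + 3 * c (i + 1)) :
    wt n x + wt n y = wt n (x + y) + 2 * ∑ i ∈ Finset.range n, c i := by
  have h1 := Finset.sum_congr rfl fun i hi => h i (Finset.mem_range.1 hi)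
  have h2 := Finset.sum_range_succ c n
  rw [Finset.sum_range_succ'] at h2
  simp only [Finset.sum_add_distrib, ← Finset.mul_sum] at h1
  unfold wt
  omega

theorem dig_add_of_wt_add {n : ℕ} (hn : 0 < n) {x y : ℤ} (h : wt n x + wt n y = wt n (x + y))
    (i : ℕ) : dig n (x + y) i = dig n x i + dig n y i := by
  obtain ⟨c, -, hc, hcarry⟩ := exists_carry hn x y
  have hsum : ∑ i ∈ Finset.range n, c i = 0 := by
    have := wt_add_of_carry hc hcarry
    omega
  have hzero : ∀ i < n, c i = 0 := fun i hi =>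
    Finset.sum_eq_zero_iff.1 hsum i (Finset.mem_range.2 hi)
  rw [← dig_mod n _ i, ← dig_mod n x i, ← dig_mod n y i]
  have hi := Nat.mod_lt i hn
  have h1 := hcarry _ hi
  have h2 := hzero _ hi
  have h3 : c (i % n + 1) = 0 := by
    rcases Nat.lt_or_ge (i % n + 1) n with h4 | h4
    · exact hzero _ h4
    · rw [show i % n + 1 = n by omega, hc, hzero 0 hn]
  omega

theorem dig_add_dig_neg {n : ℕ} (hn : 0 < n) {x : ℤ} (hx : dig n x 0 ≠ 0) {i : ℕ} (hi : i < n) :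
    dig n x i + dig n (-x) i = 2 := by
  obtain ⟨c, hc1, hc, hcarry⟩ := exists_carry hn x (-x)
  have hz : ∀ i, dig n (x + -x) i = 0 := by simp [dig]
  have hone : ∀ i < n, c (i + 1) = 1 := by
    intro i
    induction i with
    | zero =>
      intro hi
      have h1 := hcarry 0 hi
      have h2 := hc1 (0 + 1)
      rw [hz] at h1
      omega
    | succ i ih =>
      intro hi
      have h1 := hcarry (i + 1) hi
      have h2 := hc1 (i + 1 + 1)
      have h3 := ih (by omega)
      rw [hz] at h1
      omega
  have hi1 : c i = 1 := by
    cases i with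
    | zero =>
      have := hone (n - 1) (by omega)
      rwa [Nat.sub_add_cancel hn, hc] at this
    | succ i => exact hone i (by omega)
  have h1 := hcarry i hi
  rw [hz, hone i hi, hi1] at h1
  omega

theorem dig_three_mul {n : ℕ} (hn : 0 < n) (x : ℤ) (i : ℕ) :
    dig n (3 * x) (i + 1) = dig n x i := by
  obtain ⟨m, rfl⟩ : ∃ m, n = m + 1 := ⟨n - 1, by omega⟩
  have hr := res_add_one_lt hn x
  have hm := res_modEq hn x
  set r := res (m + 1) x with hr0
  have hP : 0 < 3 ^ m := by positivity
  have hdiv := Nat.mod_add_div r (3 ^ m)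
  have hmod := Nat.mod_lt r hP
  have ht : r / 3 ^ m < 3 := (Nat.div_lt_iff_lt_mul hP).2 (by rw [pow_succ] at hr; omega)
  have hres : res (m + 1) (3 * x) = 3 * (r % 3 ^ m) + r / 3 ^ m := by
    refine res_eq_of_modEq hn ?_ ?_
    · rw [pow_succ] at hr ⊢
      generalize r / 3 ^ m = t at *
      interval_cases t <;> omega
    · refine Int.ModEq.trans ?_ (hm.mul_left 3)
      refine (Int.modEq_iff_dvd).2 ⟨(r / 3 ^ m : ℕ), ?_⟩
      have hdiv' : ((r % 3 ^ m : ℕ) : ℤ) + 3 ^ m * (r / 3 ^ m : ℕ) = r := mod_cast hdiv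
      rw [← hdiv', pow_succ]
      push_cast
      ring
  rw [← dig_mod _ x i, dig_congr _ (show i + 1 ≡ i % (m + 1) + 1 [MOD m + 1] from
    ((Nat.mod_modEq i (m + 1)).symm.add_right 1))]
  have hi := Nat.mod_lt i hn
  generalize i % (m + 1) = q at *
  rcases Nat.lt_or_ge q m with hq | hq
  · rw [dig_eq_res _ (by omega : q + 1 < m + 1), dig_eq_res _ hi, hres, ← hr0, pow_succ',
      ← Nat.div_div_eq_div_mul, Nat.mul_add_div three_pos, Nat.div_eq_of_lt ht, add_zero]
    obtain ⟨p, rfl⟩ : ∃ p, m = q + (p + 1) := ⟨m - q - 1, by omega⟩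
    rw [pow_add, Nat.mod_mul_right_div_self, pow_succ', Nat.mod_mul_right_mod]
  · obtain rfl : q = m := by omega
    rw [← dig_mod, Nat.mod_self, dig_eq_res _ hn, dig_eq_res _ hi, hres, ← hr0]
    simp only [pow_zero, Nat.div_one]
    omega

theorem dig_three_pow_mul {n : ℕ} (hn : 0 < n) (k : ℕ) (x : ℤ) (i : ℕ) :
    dig n (3 ^ k * x) (i + k) = dig n x i := by
  induction k generalizing i with
  | zero => simp
  | succ k ih => rw [pow_succ', mul_assoc, ← add_assoc, dig_three_mul hn, ih]

theorem two_mul_cmD (k : ℕ) : 2 * cmD k = 3 ^ k + 1 := by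
  have h : Odd ((3 : ℤ) ^ k) := Odd.pow (by decide)
  exact Int.mul_ediv_cancel' (h.add_odd odd_one).two_dvd

/-- If doubling `x` produces exactly one carry, then only two digits of `2x` are odd. -/
theorem even_dig_add_self {n : ℕ} {x : ℤ} (h : 2 * wt n x = wt n (x + x) + 2)
    (h0 : Odd (dig n (x + x) 0)) (h1 : Odd (dig n (x + x) 1)) {p : ℕ} (hp : 2 ≤ p) (hpn : p < n) :
    Even (dig n (x + x) p) := by
  obtain ⟨c, hc1, hc, hcarry⟩ := exists_carry (show 0 < n by omega) x x
  have hsum : ∑ i ∈ Finset.range n, c i = 1 := by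
    have := wt_add_of_carry hc hcarry
    omega
  have hpair : ∀ a < n, ∀ b < n, a ≠ b → c a + c b ≤ 1 := by
    intro a ha b hb hab
    rw [← hsum, ← Finset.sum_pair hab]
    refine Finset.sum_le_sum_of_subset fun i hi => ?_
    simp only [Finset.mem_insert, Finset.mem_singleton] at hi
    rw [Finset.mem_range]
    omega
  have e0 := hcarry 0 (by omega)
  have e1 := hcarry 1 (by omega)
  have ep := hcarry p hpn
  have p02 := hpair 0 (by omega) 2 (by omega) (by omega)
  have p01 := hpair 0 (by omega) 1 (by omega) (by omega)
  have p1p := hpair 1 (by omega) p hpn (by omega)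
  have hp1 : c 1 + c (p + 1) ≤ 1 := by
    rcases Nat.lt_or_ge (p + 1) n with h2 | h2
    · exact hpair 1 (by omega) _ h2 (by omega)
    · rw [show p + 1 = n by omega, hc]
      omega
  have b0 := hc1 0
  have b2 := hc1 2
  simp only [Nat.odd_iff, Nat.even_iff, Nat.reduceAdd, zero_add] at h0 h1 e0 e1 ⊢
  have hc_one : c 1 = 1 := by
    by_contra hne
    have h2 : c 1 = 0 := by omega
    have h3 : c 0 = 1 := by omega
    have h4 : c 2 = 1 := by omega
    omega
  have h2 : c p = 0 := by omega
  have h3 : c (p + 1) = 0 := by omega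
  omega

theorem stmt2 (n k : ℕ) (hn : 2 ≤ n) (hkodd : Odd k) (hk0 : 0 < k) (hkn : k < n)
    (hgcd : Nat.gcd n k = 1) (w : ℕ) (hw0 : 0 < w) (hwn : w < n) (hwk : w * k ≡ 1 [MOD n])
    (j : ℤ) (hj : j ∈ S0 n k)
    (h0 : dig n ((3 ^ k + 1) * j) 0 = 1) (h1 : dig n ((3 ^ k + 1) * j) 1 = 1)
    (hj1 : dig n j 1 = 0) (hj0 : dig n j 0 = 1) :
    (∀ i, i ≤ w - 1 → dig n j (i * k) = 1) ∧
    dig n j (w * k) = 0 ∧ dig n j ((n - 1) * k) = 0 ∧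
    (∀ i, w + 1 ≤ i → i ≤ n - 2 → dig n j (i * k) = 0 ∨ dig n j (i * k) = 2) ∧
    (∀ i, w + 1 ≤ i → i + 1 ≤ n - 2 →
      ¬(dig n j (i * k) = 2 ∧ dig n j ((i + 1) * k) = 2)) := by
  obtain ⟨-, -, hwt, hwt2⟩ := hj
  have hn0 : 0 < n := by omega
  have hsum : j + 3 ^ k * j = (3 ^ k + 1) * j := by ring
  have hneg : -(j * cmD k) + -(j * cmD k) = -((3 ^ k + 1) * j) := by
    rw [← two_mul_cmD]
    ring
  have hneg_dig : ∀ p < n, dig n ((3 ^ k + 1) * j) p + dig n (-((3 ^ k + 1) * j)) p = 2 :=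
    fun p hp => dig_add_dig_neg hn0 (by omega) hp
  have heven : ∀ p, 2 ≤ p → p < n → dig n ((3 ^ k + 1) * j) p % 2 = 0 := by
    intro p hp hpn
    have g0 := hneg_dig 0 hn0
    have g1 := hneg_dig 1 (by omega)
    have gp := hneg_dig p hpn
    have := even_dig_add_self (x := -(j * cmD k)) (by rw [hneg, hwt2])
      (by rw [hneg, Nat.odd_iff]; omega) (by rw [hneg, Nat.odd_iff]; omega) hp hpn
    rw [hneg, Nat.even_iff] at this
    omega
  have hlt : ∀ (x : ℤ) i, dig n x i < 3 := fun x i => Nat.mod_lt _ (by norm_num)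
  have hstep : ∀ i, dig n ((3 ^ k + 1) * j) ((i + 1) * k) =
      dig n j ((i + 1) * k) + dig n j (i * k) := by
    intro i
    rw [← hsum, dig_add_of_wt_add hn0 (by rw [hsum, hwt])]
    congr 1
    rw [add_mul, one_mul, dig_three_pow_mul hn0]
  have hcancel : ∀ a < n, ∀ b < n, a * k ≡ b * k [MOD n] → a = b := fun a ha b hb h =>
    (Nat.ModEq.cancel_right_of_coprime hgcd h).eq_of_lt_of_lt ha hb
  have hsum_even : ∀ i, i + 1 < n → i + 1 ≠ w →
      (dig n j ((i + 1) * k) + dig n j (i * k) = 0 ∨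
        dig n j ((i + 1) * k) + dig n j (i * k) = 2) := by
    intro i hi hiw
    have h2 := hlt ((3 ^ k + 1) * j) ((i + 1) * k)
    have h3 : dig n ((3 ^ k + 1) * j) ((i + 1) * k) % 2 = 0 := by
      rw [← dig_mod]
      refine heven _ ?_ (Nat.mod_lt _ hn0)
      by_contra! hlt2
      have h4 := Nat.mod_modEq ((i + 1) * k) n
      obtain h5 | h5 : (i + 1) * k % n = 0 ∨ (i + 1) * k % n = 1 := by omega
      · rw [h5] at h4
        have := hcancel (i + 1) hi 0 hn0 (by simpa using h4.symm)
        omega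
      · rw [h5] at h4
        exact hiw (hcancel _ hi _ hwn (h4.symm.trans hwk.symm))
    rw [hstep] at h2 h3
    omega
  have hw : dig n j (w * k) = 0 := (dig_congr j hwk).trans hj1
  have hones : ∀ i, i ≤ w - 1 → dig n j (i * k) = 1 := by
    intro i
    induction i with
    | zero => simpa using hj0
    | succ i ih =>
      intro hi
      have h2 := ih (by omega)
      have h3 := hsum_even i (by omega) (by omega)
      omega
  have hlast : dig n j ((n - 1) * k) = 0 := by
    have h2 := hstep (n - 1)
    rw [Nat.sub_add_cancel hn0, dig_congr _ (show n * k ≡ 0 [MOD n] by simp [Nat.ModEq]),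
      dig_congr j (show n * k ≡ 0 [MOD n] by simp [Nat.ModEq])] at h2
    omega
  have htail : ∀ i, w ≤ i → i < n → dig n j (i * k) = 0 ∨ dig n j (i * k) = 2 := by
    intro i hi
    induction i, hi using Nat.le_induction with
    | base => exact fun _ => Or.inl hw
    | succ i hi ih =>
      intro hin
      have h2 := ih (by omega)
      have h3 := hsum_even i hin (by omega)
      omega
  refine ⟨hones, hw, hlast, fun i hi hi2 => htail i (by omega) (by omega), ?_⟩
  rintro i hi hi2 ⟨h2, h3⟩
  have := hsum_even i (by omega) (by omega)
  omega
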